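/- Let (V, g_V) be a finite-dimensional quadratic graded vector space of degree ℓ = 2k with k even. Then the restriction of the induced bilinear form ⟨·,·⟩ to V_{-k} is a nondegenerate symmetric bilinear form. Moreover, if (s,t) is its signature, then a graded subspace L ⊆ V is maximal isotropic if and only if L is isotropic, dim L_{-k} = min{s,t}, and dim V_{-k+i} = dim L_{-k+i} + dim L_{-k-i} for all i ≥ 1. -/

import Mathlib

variable (V : ℤ → Type) [∀ j, AddCommGroup (V j)] [∀ j, Module ℝ (V j)] (ℓ : ℤ)
  (g : ∀ j, V j ≃ₗ[ℝ] (V (-(j + ℓ)) →ₗ[ℝ] ℝ))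

/-- The degree-`j` component of the orthogonal complement `L^⊥`. -/
def gradedPerp (L : ∀ j, Submodule ℝ (V j)) (j : ℤ) : Submodule ℝ (V j) where
  carrier := {v | ∀ w ∈ L (-(j + ℓ)), g j v w = 0}
  add_mem' := by
    intro a b ha hb w hw
    simp [map_add, LinearMap.add_apply, ha w hw, hb w hw]
  zero_mem' := by
    intro w hw
    simp
  smul_mem' := by
    intro c x hx w hw
    simp [map_smul, LinearMap.smul_apply, hx w hw]

/-- A graded subspace `L` is isotropic if `L ⊆ L^⊥`. -/
def GradedIsotropic (L : ∀ j, Submodule ℝ (V j)) : Prop :=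
  ∀ j, L j ≤ gradedPerp V ℓ g L j

/-- A graded subspace is maximal isotropic if it is isotropic and is not properly contained
in any isotropic graded subspace. -/
def GradedMaximalIsotropic (L : ∀ j, Submodule ℝ (V j)) : Prop :=
  GradedIsotropic V ℓ g L ∧
    ∀ L' : ∀ j, Submodule ℝ (V j),
      GradedIsotropic V ℓ g L' → (∀ j, L j ≤ L' j) → ∀ j, L' j = L j

/-- The restriction of the induced bilinear form `⟨v,w⟩ = (-1)^{(|v|+ℓ)ℓ}[g(v)](w)` to `V_{-k}`,
in the case `ℓ = 2k`: note `-(-k + 2k) = -k`, so both arguments live in `V_{-k}`. -/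
noncomputable def restForm (k : ℤ) (g : ∀ j, V j ≃ₗ[ℝ] (V (-(j + 2 * k)) →ₗ[ℝ] ℝ))
    (v w : V (-k)) : ℝ :=
  (-1 : ℝ) ^ ((-k + 2 * k) * (2 * k)) *
    g (-k) v (cast (congrArg V (by omega : (-k : ℤ) = -(-k + 2 * k))) w)

/-- The component of `g` pairing degree `j` with degree `i`, for any `i` equal to `-(j + ℓ)`. -/
noncomputable def gradedPairing {j i : ℤ} (h : i = -(j + ℓ)) : V j ≃ₗ[ℝ] (V i →ₗ[ℝ] ℝ) := by
  subst h
  exact g j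

lemma gradedPairing_apply {j i : ℤ} (h : i = -(j + ℓ)) (v : V j) (w : V i) :
    gradedPairing V ℓ g h v w = g j v (cast (congrArg V h) w) := by
  subst h
  rfl

lemma gradedIsotropic_iff (L : ∀ j, Submodule ℝ (V j)) :
    GradedIsotropic V ℓ g L ↔ ∀ (j i : ℤ) (h : i = -(j + ℓ)), ∀ v ∈ L j, ∀ w ∈ L i,
      gradedPairing V ℓ g h v w = 0 := by
  constructor
  · intro hL j i h v hv w hw
    subst h
    exact hL j hv w hw
  · intro hL j v hv w hw
    exact hL j _ rfl v hv w hw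

lemma GradedIsotropic.update {L : ∀ j, Submodule ℝ (V j)} (hL : GradedIsotropic V ℓ g L)
    (hrefl : ∀ (j i : ℤ) (h : i = -(j + ℓ)) (h' : j = -(i + ℓ)) (v : V j) (w : V i),
      gradedPairing V ℓ g h v w = 0 → gradedPairing V ℓ g h' w v = 0)
    (j : ℤ) (W : Submodule ℝ (V j))
    (hW : ∀ (i : ℤ) (h : i = -(j + ℓ)), ∀ v ∈ W, ∀ w ∈ Function.update L j W i,
      gradedPairing V ℓ g h v w = 0) :
    GradedIsotropic V ℓ g (Function.update L j W) := by
  rw [gradedIsotropic_iff] at hL ⊢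
  intro a b h v hv w hw
  by_cases ha : a = j
  · subst ha
    rw [Function.update_self] at hv
    exact hW b h v hv w hw
  · by_cases hb : b = j
    · subst hb
      rw [Function.update_self] at hw
      exact hrefl _ _ (by omega) h _ _ (hW a (by omega) w hw v hv)
    · rw [Function.update_of_ne ha] at hv
      rw [Function.update_of_ne hb] at hw
      exact hL a b h v hv w hw

lemma le_update_of_le {L : ∀ j, Submodule ℝ (V j)} {j : ℤ} {W : Submodule ℝ (V j)}
    (h : L j ≤ W) (i : ℤ) : L i ≤ Function.update L j W i := by
  by_cases hi : i = j
  · subst hi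
    rwa [Function.update_self]
  · rw [Function.update_of_ne hi]

/-- The left annihilator of a subspace has complementary dimension under a perfect pairing. -/
lemma finrank_comap_dualAnnihilator_add_finrank {U U' : Type*} [AddCommGroup U] [Module ℝ U]
    [AddCommGroup U'] [Module ℝ U'] [FiniteDimensional ℝ U'] (e : U ≃ₗ[ℝ] (U' →ₗ[ℝ] ℝ))
    (M : Submodule ℝ U') :
    Module.finrank ℝ ((M.dualAnnihilator).comap (e : U →ₗ[ℝ] Module.Dual ℝ U')) +
      Module.finrank ℝ M = Module.finrank ℝ U' := by
  rw [← Subspace.finrank_add_finrank_dualAnnihilator_eq M, add_comm]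
  congr 1
  exact (e.submoduleMap _).finrank_eq.trans
    (congrArg (fun S : Submodule ℝ (Module.Dual ℝ U') => Module.finrank ℝ S)
      (Submodule.map_comap_eq_of_surjective e.surjective _))

lemma GradedIsotropic.finrank_add_finrank_le [∀ j, FiniteDimensional ℝ (V j)]
    {L : ∀ j, Submodule ℝ (V j)} (hL : GradedIsotropic V ℓ g L) {j i : ℤ} (h : i = -(j + ℓ)) :
    Module.finrank ℝ (L j) + Module.finrank ℝ (L i) ≤ Module.finrank ℝ (V i) := by
  rw [← finrank_comap_dualAnnihilator_add_finrank (gradedPairing V ℓ g h) (L i)]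
  gcongr
  apply Submodule.finrank_mono
  intro v hv
  rw [Submodule.mem_comap, Submodule.mem_dualAnnihilator]
  exact (gradedIsotropic_iff V ℓ g L).1 hL j i h v hv

lemma GradedMaximalIsotropic.finrank_add_finrank_eq [∀ j, FiniteDimensional ℝ (V j)]
    {L : ∀ j, Submodule ℝ (V j)} (hL : GradedMaximalIsotropic V ℓ g L)
    (hrefl : ∀ (j i : ℤ) (h : i = -(j + ℓ)) (h' : j = -(i + ℓ)) (v : V j) (w : V i),
      gradedPairing V ℓ g h v w = 0 → gradedPairing V ℓ g h' w v = 0)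
    {j i : ℤ} (h : i = -(j + ℓ)) (hij : i ≠ j) :
    Module.finrank ℝ (L j) + Module.finrank ℝ (L i) = Module.finrank ℝ (V i) := by
  rw [← finrank_comap_dualAnnihilator_add_finrank (gradedPairing V ℓ g h) (L i)]
  set W := (L i).dualAnnihilator.comap
    (gradedPairing V ℓ g h : V j →ₗ[ℝ] Module.Dual ℝ (V i)) with hW
  have hmem : ∀ v, v ∈ W ↔ ∀ w ∈ L i, gradedPairing V ℓ g h v w = 0 := by
    intro v
    rw [hW, Submodule.mem_comap, Submodule.mem_dualAnnihilator]
    rfl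
  have hle : L j ≤ W := fun v hv =>
    (hmem v).2 ((gradedIsotropic_iff V ℓ g L).1 hL.1 j i h v hv)
  have := hL.2 (Function.update L j W) (hL.1.update V ℓ g hrefl j W ?_) (le_update_of_le V hle) j
  · rw [Function.update_self] at this
    rw [this]
  · intro i' h' v hv w hw
    obtain rfl : i = i' := h.trans h'.symm
    rw [Function.update_of_ne hij] at hw
    exact (hmem v).1 hv w hw

section SymmetricForm

variable {U : Type*} [AddCommGroup U] [Module ℝ U] [FiniteDimensional ℝ U]

lemma finrank_add_finrank_le_of_isotropic_of_anisotropic (B : U →ₗ[ℝ] U →ₗ[ℝ] ℝ)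
    {W N : Submodule ℝ U} (hW : ∀ v ∈ W, B v v = 0) (hN : ∀ v ∈ N, v ≠ 0 → B v v ≠ 0) :
    Module.finrank ℝ W + Module.finrank ℝ N ≤ Module.finrank ℝ U := by
  apply Submodule.finrank_add_finrank_le_of_disjoint
  rw [Submodule.disjoint_def]
  intro v hv hv'
  by_contra hne
  exact hN v hv' hne (hW v hv)

lemma exists_ne_zero_mem_forall_eq_zero (B : U →ₗ[ℝ] U →ₗ[ℝ] ℝ) {W P : Submodule ℝ U}
    (h : Module.finrank ℝ W < Module.finrank ℝ P) :
    ∃ p ∈ P, p ≠ 0 ∧ ∀ w ∈ W, B p w = 0 := by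
  let f : P →ₗ[ℝ] Module.Dual ℝ W := (W.dualRestrict).comp (B.comp P.subtype)
  have hf : LinearMap.ker f ≠ ⊥ := LinearMap.ker_ne_bot_of_finrank_lt (by
    rwa [Subspace.dual_finrank_eq])
  obtain ⟨p, hp, hp0⟩ := (Submodule.ne_bot_iff _).1 hf
  refine ⟨p, p.2, by simpa using hp0, fun w hw => ?_⟩
  exact LinearMap.congr_fun (LinearMap.mem_ker.1 hp) ⟨w, hw⟩

/-- An isotropic subspace of dimension smaller than both indices of a symmetric form is not
maximal. -/
lemma exists_isotropic_gt (B : U →ₗ[ℝ] U →ₗ[ℝ] ℝ) (hB : ∀ v w, B v w = B w v)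
    {P N W : Submodule ℝ U} (hP : ∀ v ∈ P, v ≠ 0 → 0 < B v v)
    (hN : ∀ v ∈ N, v ≠ 0 → B v v < 0) (hPN : ∀ v ∈ P, ∀ w ∈ N, B v w = 0)
    (hW : ∀ v ∈ W, ∀ w ∈ W, B v w = 0)
    (hWP : Module.finrank ℝ W < Module.finrank ℝ P)
    (hWN : Module.finrank ℝ W < Module.finrank ℝ N) :
    ∃ W', W < W' ∧ ∀ v ∈ W', ∀ w ∈ W', B v w = 0 := by
  obtain ⟨p, hpP, hp0, hpW⟩ := exists_ne_zero_mem_forall_eq_zero B hWP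
  obtain ⟨n, hnN, hn0, hnW⟩ := exists_ne_zero_mem_forall_eq_zero B hWN
  have hpp := hP p hpP hp0
  have hnn := hN n hnN hn0
  have hpn := hPN p hpP n hnN
  have hnp : B n p = 0 := hB n p ▸ hpn
  set c := √(B p p / -B n n) with hc
  have hcc : c * c * B n n = -B p p := by
    rw [hc, Real.mul_self_sqrt (div_nonneg hpp.le (by linarith))]
    field_simp [hnn.ne]
  set x := p + c • n with hx
  have hxx : B x x = 0 := by
    simp only [hx, map_add, map_smul, LinearMap.add_apply, LinearMap.smul_apply, smul_eq_mul,
      hpn, hnp]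
    linarith
  have hxW : ∀ w ∈ W, B x w = 0 := fun w hw => by
    simp [hx, hpW w hw, hnW w hw]
  have hxnot : x ∉ W := fun h => by
    have := hpW x h
    simp only [hx, map_add, map_smul, hpn, smul_zero, add_zero] at this
    exact hpp.ne' this
  refine ⟨W ⊔ ℝ ∙ x, left_lt_sup.2 fun h => hxnot (h (Submodule.mem_span_singleton_self x)), ?_⟩
  intro v hv w hw
  obtain ⟨a, ha, b, hb, rfl⟩ := Submodule.mem_sup.1 hv
  obtain ⟨a', ha', b', hb', rfl⟩ := Submodule.mem_sup.1 hw
  obtain ⟨r, rfl⟩ := Submodule.mem_span_singleton.1 hb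
  obtain ⟨r', rfl⟩ := Submodule.mem_span_singleton.1 hb'
  simp [hW a ha a' ha', hxW a' ha', hB a x, hxW a ha, hxx]

end SymmetricForm

/-- Let `(V, g_V)` be a finite-dimensional quadratic graded vector space of degree
`ℓ = 2k` with `k` even.  Then the induced bilinear form restricted to `V_{-k}` is a
nondegenerate symmetric bilinear form, and if `(s,t)` is its signature (witnessed by an
orthogonal decomposition into a positive and a negative definite subspace of dimensions `s`,`t`),
then a graded subspace `L` is maximal isotropic iff it is isotropic, `dim L_{-k} = min s t`, and
`dim V_{-k+i} = dim L_{-k+i} + dim L_{-k-i}` for all `i ≥ 1`. -/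
theorem stmt_3 (k : ℤ) (hk : Even k)
    (V : ℤ → Type) [∀ j, AddCommGroup (V j)] [∀ j, Module ℝ (V j)]
    [∀ j, FiniteDimensional ℝ (V j)]
    (g : ∀ j, V j ≃ₗ[ℝ] (V (-(j + 2 * k)) →ₗ[ℝ] ℝ))
    (hsymm : ∀ (j : ℤ) (v : V j) (w : V (-(j + 2 * k))),
      (-1 : ℝ) ^ ((j + 2 * k) * (2 * k)) * g j v w
        = (-1 : ℝ) ^ ((j + 2 * k) * (-(j + 2 * k) + 2 * k)) *
            ((-1 : ℝ) ^ ((-(j + 2 * k) + 2 * k) * (2 * k)) *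
              g (-(j + 2 * k)) w
                (cast (congrArg V (by omega : j = -(-(j + 2 * k) + 2 * k))) v))) :
    -- the restricted form is symmetric and nondegenerate
    (∀ v w : V (-k), restForm V k g v w = restForm V k g w v) ∧
    (∀ v : V (-k), (∀ w : V (-k), restForm V k g v w = 0) → v = 0) ∧
    -- the characterization of maximal isotropic graded subspaces in terms of the signature
    (∀ (s t : ℕ) (P N : Submodule ℝ (V (-k))),
      IsCompl P N →
      (∀ v ∈ P, v ≠ 0 → 0 < restForm V k g v v) →
      (∀ v ∈ N, v ≠ 0 → restForm V k g v v < 0) →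
      (∀ v ∈ P, ∀ w ∈ N, restForm V k g v w = 0) →
      Module.finrank ℝ P = s → Module.finrank ℝ N = t →
      ∀ L : ∀ j, Submodule ℝ (V j),
        (GradedMaximalIsotropic V (2 * k) g L ↔
          (GradedIsotropic V (2 * k) g L ∧
            Module.finrank ℝ (L (-k)) = min s t ∧
            ∀ i : ℕ, 1 ≤ i →
              Module.finrank ℝ (V (-k + i))
                = Module.finrank ℝ (L (-k + i)) + Module.finrank ℝ (L (-k - i))))) := by
  have hsgn : ∀ m : ℤ, (-1 : ℝ) ^ (m * (2 * k)) = 1 := fun m =>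
    Even.neg_one_zpow ((even_two_mul k).mul_left m)
  have hpair : ∀ (j i : ℤ) (h : i = -(j + 2 * k)) (h' : j = -(i + 2 * k)) (v : V j) (w : V i),
      gradedPairing V (2 * k) g h v w =
        (-1 : ℝ) ^ ((j + 2 * k) * (i + 2 * k)) * gradedPairing V (2 * k) g h' w v := by
    intro j i h h' v w
    subst h
    have := hsymm j v w
    rw [hsgn, hsgn, one_mul, one_mul] at this
    rw [gradedPairing_apply V (2 * k) g h']
    exact this
  have hrefl : ∀ (j i : ℤ) (h : i = -(j + 2 * k)) (h' : j = -(i + 2 * k)) (v : V j) (w : V i),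
      gradedPairing V (2 * k) g h v w = 0 → gradedPairing V (2 * k) g h' w v = 0 := by
    intro j i h h' v w hvw
    rw [hpair i j h' h, hvw, mul_zero]
  have hmid : (-k : ℤ) = -(-k + 2 * k) := by omega
  set B : V (-k) →ₗ[ℝ] V (-k) →ₗ[ℝ] ℝ :=
    (gradedPairing V (2 * k) g hmid).toLinearMap with hBdef
  have hrest : ∀ v w, restForm V k g v w = B v w := by
    intro v w
    rw [restForm, hsgn, one_mul]
    exact (gradedPairing_apply V (2 * k) g hmid v w).symm
  have hBsymm : ∀ v w, B v w = B w v := by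
    intro v w
    have heven : Even ((-k + 2 * k) * (-k + 2 * k)) := by
      rw [show -k + 2 * k = k by ring]
      exact hk.mul_left k
    have := hpair _ _ hmid hmid v w
    rwa [heven.neg_one_zpow, one_mul] at this
  simp only [hrest]
  refine ⟨hBsymm, ?_, ?_⟩
  · intro v hv
    exact (gradedPairing V (2 * k) g hmid).map_eq_zero_iff.1 (LinearMap.ext hv)
  intro s t P N hPN hP hN horth hs ht L
  have hdim : s + t = Module.finrank ℝ (V (-k)) := by
    rw [← hs, ← ht]
    exact Submodule.finrank_add_eq_of_isCompl hPN
  have hBiso : ∀ L : ∀ j, Submodule ℝ (V j), GradedIsotropic V (2 * k) g L →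
      ∀ v ∈ L (-k), ∀ w ∈ L (-k), B v w = 0 := fun L hL =>
    (gradedIsotropic_iff V (2 * k) g L).1 hL _ _ hmid
  have hmin : ∀ L : ∀ j, Submodule ℝ (V j), GradedIsotropic V (2 * k) g L →
      Module.finrank ℝ (L (-k)) ≤ min s t := by
    intro L hL
    have hdiag : ∀ v ∈ L (-k), B v v = 0 := fun v hv => hBiso L hL v hv v hv
    have h₁ := finrank_add_finrank_le_of_isotropic_of_anisotropic B hdiag
      (fun v hv h0 => (hP v hv h0).ne')
    have h₂ := finrank_add_finrank_le_of_isotropic_of_anisotropic B hdiag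
      (fun v hv h0 => (hN v hv h0).ne)
    omega
  constructor
  · intro hL
    refine ⟨hL.1, le_antisymm (hmin L hL.1) ?_, fun i hi => ?_⟩
    · by_contra! hlt
      obtain ⟨W, hLW, hW⟩ := exists_isotropic_gt B hBsymm hP hN horth (hBiso L hL.1)
        (by omega) (by omega)
      have := hL.2 (Function.update L (-k) W) (hL.1.update V (2 * k) g hrefl _ W ?_)
        (le_update_of_le V hLW.le) (-k)
      · rw [Function.update_self] at this
        exact hLW.ne this.symm
      · intro i h v hv w hw
        obtain rfl : i = -k := by omega
        rw [Function.update_self] at hw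
        exact hW v hv w hw
    · rw [← hL.finrank_add_finrank_eq V (2 * k) g hrefl
        (show -k + (i : ℤ) = -(-k - i + 2 * k) by ring) (by omega), add_comm]
  · rintro ⟨hL, hk', hi⟩
    refine ⟨hL, fun L' hL' hle => ?_⟩
    have hpos : ∀ i : ℕ, 1 ≤ i → Module.finrank ℝ (L' (-k + i)) = Module.finrank ℝ (L (-k + i)) ∧
        Module.finrank ℝ (L' (-k - i)) = Module.finrank ℝ (L (-k - i)) := by
      intro i h1
      have h₁ := hL'.finrank_add_finrank_le V (2 * k) g
        (show -k + (i : ℤ) = -(-k - i + 2 * k) by ring)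
      have h₂ := hi i h1
      have h₃ := Submodule.finrank_mono (hle (-k + i))
      have h₄ := Submodule.finrank_mono (hle (-k - i))
      omega
    intro j
    refine (Submodule.eq_of_le_of_finrank_eq (hle j) ?_).symm
    rcases lt_trichotomy j (-k) with hj | rfl | hj
    · obtain ⟨i, rfl⟩ : ∃ i : ℕ, j = -k - i := ⟨(-k - j).toNat, by omega⟩
      exact (hpos i (by omega)).2.symm
    · exact le_antisymm (Submodule.finrank_mono (hle _)) (hk' ▸ hmin L' hL')
    · obtain ⟨i, rfl⟩ : ∃ i : ℕ, j = -k + i := ⟨(j + k).toNat, by omega⟩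
      exact (hpos i (by omega)).1.symm
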